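/- Let n ≥ 2. Then 2^{−(n+1)/2} ∫_{S^{n−1}} (1 − x₁)^{−(n−3)/2} dσ(x) = (1/2) ∫_{S^{n−1}} |x₁| dσ(x). -/

import Mathlib

open MeasureTheory

section

open Metric Module Set Filter Topology Real
open scoped ENNReal RealInnerProductSpace

theorem LocallyLipschitz.hausdorffMeasure_image_lt_top {X Y : Type*}
    [EMetricSpace X] [MeasurableSpace X] [BorelSpace X]
    [EMetricSpace Y] [MeasurableSpace Y] [BorelSpace Y]
    {f : X → Y} (hf : LocallyLipschitz f) {d : ℝ} (hd : 0 ≤ d)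
    [IsLocallyFiniteMeasure (μH[d] : Measure X)] {K : Set X} (hK : IsCompact K) :
    μH[d] (f '' K) < ∞ := by
  refine hK.induction_on (by simp) (fun s t hst ht ↦ (measure_mono (image_mono hst)).trans_lt ht)
    (fun s t hs ht ↦ ?_) fun x _ ↦ ?_
  · rw [image_union]
    exact measure_union_lt_top hs ht
  · obtain ⟨C, t, ht, hC⟩ := hf x
    obtain ⟨u, hu, hu'⟩ := (μH[d] : Measure X).finiteAt_nhds x
    refine ⟨t ∩ u, mem_nhdsWithin_of_mem_nhds (inter_mem ht hu), ?_⟩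
    refine ((hC.mono inter_subset_left).hausdorffMeasure_image_le hd).trans_lt ?_
    exact ENNReal.mul_lt_top (ENNReal.rpow_lt_top_of_nonneg hd ENNReal.coe_ne_top)
      ((measure_mono inter_subset_right).trans_lt hu')

section InnerProductSpace

variable {E : Type*} [NormedAddCommGroup E] [InnerProductSpace ℝ E] [MeasurableSpace E]
  [BorelSpace E]

theorem hausdorffMeasure_hemisphere_lt_top {m : ℕ} [Fact (finrank ℝ E = m + 1)]
    {v : E} (hv : ‖v‖ = 1) :
    μH[(m : ℝ)] (sphere (0 : E) 1 ∩ {x | ⟪v, x⟫ ≤ 0}) < ∞ := by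
  have : FiniteDimensional ℝ E := .of_fact_finrank_eq_succ m
  have hd : finrank ℝ (ℝ ∙ v)ᗮ = m :=
    Submodule.finrank_orthogonal_span_singleton (norm_ne_zero_iff.1 (by simp [hv]))
  have : (μH[(m : ℝ)] : Measure (ℝ ∙ v)ᗮ).IsAddHaarMeasure := by
    have := isAddHaarMeasure_hausdorffMeasure (E := (ℝ ∙ v)ᗮ)
    rwa [hd] at this
  have hK : IsCompact (sphere (0 : E) 1 ∩ {x | ⟪v, x⟫ ≤ 0}) :=
    (isCompact_sphere 0 1).inter_right (isClosed_le (by fun_prop) (by fun_prop))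
  have hlip : LocallyLipschitz fun w : (ℝ ∙ v)ᗮ ↦ stereoInvFunAux v w :=
    (contDiff_stereoInvFunAux.comp (ℝ ∙ v)ᗮ.subtypeL.contDiff).locallyLipschitz
  have hcont : ContinuousOn (stereoToFun v) (sphere (0 : E) 1 ∩ {x | ⟪v, x⟫ ≤ 0}) := by
    refine continuousOn_stereoToFun.mono fun x hx h ↦ ?_
    have h1 : ⟪v, x⟫ ≤ 0 := hx.2
    rw [innerSL_apply_apply] at h
    linarith
  refine (measure_mono ?_).trans_lt
    (hlip.hausdorffMeasure_image_lt_top m.cast_nonneg (hK.image_of_continuousOn hcont))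
  intro x hx
  refine ⟨_, mem_image_of_mem _ hx, ?_⟩
  refine congrArg Subtype.val (stereo_left_inv hv (x := ⟨x, hx.1⟩) ?_)
  intro (hxv : x = v)
  have h1 : ⟪v, x⟫ ≤ 0 := hx.2
  rw [hxv, real_inner_self_eq_norm_sq, hv] at h1
  norm_num at h1

theorem hausdorffMeasure_sphere_lt_top {m : ℕ} [Fact (finrank ℝ E = m + 1)] :
    μH[(m : ℝ)] (sphere (0 : E) 1) < ∞ := by
  have : Nontrivial E := nontrivial_of_finrank_eq_succ (Fact.out : finrank ℝ E = m + 1)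
  obtain ⟨v, hv⟩ := exists_norm_eq E zero_le_one
  refine (measure_mono fun x hx ↦ ?_).trans_lt (measure_union_lt_top
    (hausdorffMeasure_hemisphere_lt_top hv)
    (hausdorffMeasure_hemisphere_lt_top (v := -v) (by rwa [norm_neg])))
  rcases le_total ⟪v, x⟫ 0 with h | h
  · exact .inl ⟨hx, h⟩
  · exact .inr ⟨hx, by simpa [inner_neg_left] using h⟩

/-- Integrals of functions of `⟪x, u⟫` and `‖x‖` against a rotation-invariant measure depend on `u`
only through its norm. -/
theorem lintegral_inner_norm_eq_of_norm_eq {ν : Measure E}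
    (hν : ∀ e : E ≃ₗᵢ[ℝ] E, MeasurePreserving e ν ν) (F : ℝ → ℝ → ℝ≥0∞) {u u' : E}
    (h : ‖u‖ = ‖u'‖) :
    ∫⁻ x, F ⟪x, u⟫ ‖x‖ ∂ν = ∫⁻ x, F ⟪x, u'⟫ ‖x‖ ∂ν := by
  let e := (ℝ ∙ (u - u'))ᗮ.reflection
  have he : e u = u' := Submodule.reflection_sub h
  rw [← (hν e).lintegral_comp_emb e.toHomeomorph.measurableEmbedding
    (fun x ↦ F ⟪x, u'⟫ ‖x‖)]
  simp_rw [← he, e.inner_map_map, e.norm_map]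

end InnerProductSpace

section Cone

variable {W : Type*} [NormedAddCommGroup W] [NormedSpace ℝ W] [FiniteDimensional ℝ W]
  [MeasurableSpace W] [BorelSpace W] (μ : Measure W) [μ.IsAddHaarMeasure]

theorem lintegral_eq_ofReal_pow_mul_lintegral_comp_smul {c : ℝ} (hc : 0 < c) (f : W → ℝ≥0∞) :
    ∫⁻ x, f x ∂μ = ENNReal.ofReal (c ^ finrank ℝ W) * ∫⁻ x, f (c • x) ∂μ := by
  have hemb : MeasurableEmbedding fun x : W ↦ c • x :=
    (Homeomorph.smulOfNeZero c hc.ne').measurableEmbedding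
  rw [← hemb.lintegral_map, Measure.map_addHaar_smul μ hc.ne', lintegral_smul_measure,
    smul_eq_mul, ← mul_assoc, ← ENNReal.ofReal_mul (by positivity), abs_of_pos (by positivity),
    mul_inv_cancel₀ (by positivity), ENNReal.ofReal_one, one_mul]

theorem lintegral_lintegral_cone [Nontrivial W] {g : ℝ → ℝ≥0∞} (hg : Measurable g) :
    ∫⁻ z : W, (∫⁻ t : ℝ, if √(t ^ 2 + ‖z‖ ^ 2) < 1 then g (t / √(t ^ 2 + ‖z‖ ^ 2)) else 0) ∂μ =
      (∫⁻ z : W, (if ‖z‖ < 1 then ENNReal.ofReal ‖z‖ else 0) ∂μ) *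
        ∫⁻ v : ℝ, g (v / √(1 + v ^ 2)) *
          ENNReal.ofReal ((√(1 + v ^ 2))⁻¹ ^ (finrank ℝ W + 1)) := by
  have inner_scale : ∀ᵐ z : W ∂μ,
      ∫⁻ t : ℝ, (if √(t ^ 2 + ‖z‖ ^ 2) < 1 then g (t / √(t ^ 2 + ‖z‖ ^ 2)) else 0) =
        ∫⁻ v : ℝ, ENNReal.ofReal ‖z‖ *
          (if ‖z‖ * √(1 + v ^ 2) < 1 then g (v / √(1 + v ^ 2)) else 0) := by
    filter_upwards [Measure.ae_ne μ 0] with z hz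
    have hz' : 0 < ‖z‖ := norm_pos_iff.2 hz
    rw [lintegral_eq_ofReal_pow_mul_lintegral_comp_smul volume hz',
      lintegral_const_mul' _ _ ENNReal.ofReal_ne_top, finrank_self, pow_one]
    congr 1
    refine lintegral_congr fun v ↦ ?_
    have hs : √((‖z‖ • v) ^ 2 + ‖z‖ ^ 2) = ‖z‖ * √(1 + v ^ 2) := by
      rw [← Real.sqrt_sq hz'.le, ← Real.sqrt_mul (by positivity), Real.sqrt_sq hz'.le]
      congr 1
      simp only [smul_eq_mul]
      ring
    rw [hs, smul_eq_mul, mul_div_mul_left _ _ hz'.ne']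
  have outer_scale (v : ℝ) :
      ∫⁻ z : W, ENNReal.ofReal ‖z‖ *
          (if ‖z‖ * √(1 + v ^ 2) < 1 then g (v / √(1 + v ^ 2)) else 0) ∂μ =
        (∫⁻ z : W, (if ‖z‖ < 1 then ENNReal.ofReal ‖z‖ else 0) ∂μ) *
          (g (v / √(1 + v ^ 2)) * ENNReal.ofReal ((√(1 + v ^ 2))⁻¹ ^ (finrank ℝ W + 1))) := by
    have hv : 0 < √(1 + v ^ 2) := by positivity
    have hm : Measurable fun z : W ↦ if ‖z‖ < 1 then ENNReal.ofReal ‖z‖ else 0 :=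
      Measurable.ite (measurableSet_lt (by fun_prop) (by fun_prop)) (by fun_prop) (by fun_prop)
    rw [lintegral_eq_ofReal_pow_mul_lintegral_comp_smul μ (inv_pos.2 hv),
      ← lintegral_const_mul' _ _ ENNReal.ofReal_ne_top, ← lintegral_mul_const _ hm]
    refine lintegral_congr fun z ↦ ?_
    rw [norm_smul, norm_inv, Real.norm_of_nonneg hv.le, mul_comm (_⁻¹) ‖z‖,
      inv_mul_cancel_right₀ hv.ne', ENNReal.ofReal_mul (norm_nonneg z), pow_succ _⁻¹,
      ENNReal.ofReal_mul (p := _ ^ _) (by positivity)]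
    split_ifs <;> ring
  rw [lintegral_congr_ae inner_scale, lintegral_lintegral_swap]
  · simp_rw [outer_scale]
    exact lintegral_const_mul _ (by fun_prop)
  · refine Measurable.aemeasurable (Measurable.mul (by fun_prop) ?_)
    exact Measurable.ite (measurableSet_lt (by fun_prop) (by fun_prop)) (by fun_prop) (by fun_prop)

end Cone

theorem lintegral_ball_direction {m : ℕ} [NeZero m] {g : ℝ → ℝ≥0∞} (hg : Measurable g) :
    ∫⁻ y : EuclideanSpace ℝ (Fin (m + 1)), (if ‖y‖ < 1 then g (y 0 / ‖y‖) else 0) =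
      (∫⁻ z : EuclideanSpace ℝ (Fin m), if ‖z‖ < 1 then ENNReal.ofReal ‖z‖ else 0) *
        ∫⁻ v : ℝ, g (v / √(1 + v ^ 2)) * ENNReal.ofReal ((√(1 + v ^ 2))⁻¹ ^ (m + 1)) := by
  have hnorm (y : EuclideanSpace ℝ (Fin (m + 1))) :
      ‖y‖ = √((y 0) ^ 2 + ‖WithLp.toLp 2 (fun i : Fin m ↦ y i.succ)‖ ^ 2) := by
    rw [EuclideanSpace.norm_eq, EuclideanSpace.norm_sq_eq, Fin.sum_univ_succ]
    simp
  have := lintegral_lintegral_cone (volume : Measure (EuclideanSpace ℝ (Fin m))) hg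
  rw [finrank_euclideanSpace_fin] at this
  rw [← this, ← (PiLp.volume_preserving_toLp (Fin m)).lintegral_comp_emb
      (MeasurableEquiv.toLp 2 _).measurableEmbedding,
    ← (PiLp.volume_preserving_toLp (Fin (m + 1))).lintegral_comp_emb
      (MeasurableEquiv.toLp 2 _).measurableEmbedding,
    ← (volume_preserving_piFinSuccAbove (fun _ : Fin (m + 1) => ℝ) 0).symm.lintegral_comp_emb
      (MeasurableEquiv.measurableEmbedding _), Measure.volume_eq_prod, lintegral_prod_symm']
  · simp_rw [hnorm]
    simp [MeasurableEquiv.piFinSuccAbove]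
  · have hF : Measurable fun y : EuclideanSpace ℝ (Fin (m + 1)) ↦
        if ‖y‖ < 1 then g (y 0 / ‖y‖) else 0 :=
      Measurable.ite (measurableSet_lt (by fun_prop) (by fun_prop)) (by fun_prop) (by fun_prop)
    exact hF.comp ((MeasurableEquiv.toLp 2 _).measurable.comp
      (MeasurableEquiv.piFinSuccAbove (fun _ ↦ ℝ) 0).symm.measurable)

/-- Averaging `∫ g ⟪x, u⟫ dσ(x)` over all directions `u` compares a rotation-invariant measure `σ`
on the sphere with the Lebesgue measure on the ball. -/
theorem volume_ball_mul_lintegral_sphere {E : Type*} [NormedAddCommGroup E]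
    [InnerProductSpace ℝ E] [FiniteDimensional ℝ E] [MeasurableSpace E] [BorelSpace E]
    {σ : Measure E} [SFinite σ] (hσ : ∀ e : E ≃ₗᵢ[ℝ] E, MeasurePreserving e σ σ)
    (hσ1 : ∀ᵐ x ∂σ, ‖x‖ = 1) {g : ℝ → ℝ≥0∞} (hg : Measurable g) {u : E} (hu : ‖u‖ = 1) :
    volume (ball (0 : E) 1) * ∫⁻ x, g ⟪x, u⟫ ∂σ =
      σ univ * ∫⁻ y : E, if ‖y‖ < 1 then g (⟪y, u⟫ / ‖y‖) else 0 := by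
  have : Nontrivial E := nontrivial_of_ne u 0 (norm_ne_zero_iff.1 (by simp [hu]))
  have hmeas : Measurable fun p : E × E ↦ if ‖p.2‖ < 1 then g (⟪p.1, p.2⟫ / ‖p.2‖) else 0 :=
    Measurable.ite (measurableSet_lt (by fun_prop) (by fun_prop)) (by fun_prop) (by fun_prop)
  have integral_left : ∀ᵐ y : E, ∫⁻ x, (if ‖y‖ < 1 then g (⟪x, y⟫ / ‖y‖) else 0) ∂σ =
      (ball (0 : E) 1).indicator (fun _ ↦ ∫⁻ x, g ⟪x, u⟫ ∂σ) y := by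
    filter_upwards [Measure.ae_ne volume 0] with y hy
    by_cases h : ‖y‖ < 1
    · have h1 : ‖‖y‖⁻¹ • y‖ = ‖u‖ := by
        rw [hu, norm_smul, norm_inv, norm_norm, inv_mul_cancel₀ (norm_ne_zero_iff.2 hy)]
      rw [indicator_of_mem (by simpa using h),
        ← lintegral_inner_norm_eq_of_norm_eq hσ (fun a _ ↦ g a) h1]
      simp [h, inner_smul_right, div_eq_inv_mul]
    · rw [indicator_of_notMem (by simpa using h)]
      simp [h]
  have integral_right : ∀ᵐ x ∂σ, ∫⁻ y : E, (if ‖y‖ < 1 then g (⟪x, y⟫ / ‖y‖) else 0) =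
      ∫⁻ y : E, if ‖y‖ < 1 then g (⟪y, u⟫ / ‖y‖) else 0 := by
    filter_upwards [hσ1] with x hx
    simp_rw [← real_inner_comm x]
    exact lintegral_inner_norm_eq_of_norm_eq (fun e ↦ e.measurePreserving)
      (fun a b ↦ if b < 1 then g (a / b) else 0) (hx.trans hu.symm)
  calc
    _ = ∫⁻ y : E, ∫⁻ x, (if ‖y‖ < 1 then g (⟪x, y⟫ / ‖y‖) else 0) ∂σ := by
      rw [lintegral_congr_ae integral_left, lintegral_indicator_const measurableSet_ball, mul_comm]
    _ = ∫⁻ x, (∫⁻ y : E, if ‖y‖ < 1 then g (⟪x, y⟫ / ‖y‖) else 0) ∂σ :=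
      lintegral_lintegral_swap (hmeas.comp measurable_swap).aemeasurable
    _ = _ := by rw [lintegral_congr_ae integral_right, lintegral_const, mul_comm]

theorem integral_of_hasDerivAt_of_nonneg {f f' : ℝ → ℝ} {a b : ℝ}
    (hderiv : ∀ x, HasDerivAt f (f' x) x) (hf' : ∀ x, 0 ≤ f' x)
    (hbot : Tendsto f atBot (𝓝 a)) (htop : Tendsto f atTop (𝓝 b)) : ∫ x, f' x = b - a := by
  refine integral_of_hasDerivAt_of_tendsto hderiv ?_ hbot htop
  have h2 : IntegrableOn f' (Ioi 0) :=
    integrableOn_Ioi_deriv_of_nonneg' (fun x _ ↦ hderiv x) (fun x _ ↦ hf' x) htop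
  have h1 : IntegrableOn (fun x ↦ f' (-x)) (Ioi 0) := by
    refine integrableOn_Ioi_deriv_of_nonneg' (g := fun x ↦ -f (-x)) (fun x _ ↦ ?_)
      (fun x _ ↦ hf' _) (hbot.comp tendsto_neg_atTop_atBot).neg
    exact (((hderiv (-x)).comp x (hasDerivAt_neg x)).neg).congr_deriv (by simp)
  rw [← integrableOn_univ, ← Iic_union_Ioi (a := 0)]
  refine IntegrableOn.union ?_ h2
  rw [← integrableOn_Ici_iff_integrableOn_Ioi] at h1
  simpa using h1.comp_neg

theorem integral_cone_rpow {m : ℕ} (hm : m ≠ 0) :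
    ∫ v : ℝ, (1 - v / √(1 + v ^ 2)) ^ ((2 - (m : ℝ)) / 2) * (√(1 + v ^ 2))⁻¹ ^ (m + 1) =
      2 / m * 2 ^ ((m : ℝ) / 2) := by
  have hm0 : (m : ℝ) ≠ 0 := by exact_mod_cast hm
  simp_rw [inv_eq_one_div, ← sin_arctan, ← cos_arctan]
  have hF : Continuous fun x : ℝ ↦ 2 / m * (1 + sin x) ^ ((m : ℝ) / 2) := by
    refine continuous_const.mul (Continuous.rpow_const (by fun_prop) fun x ↦ .inr (by positivity))
  have htop := (hF.tendsto (π / 2)).comp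
    (tendsto_arctan_atTop.mono_right nhdsWithin_le_nhds)
  have hbot := (hF.tendsto (-(π / 2))).comp
    (tendsto_arctan_atBot.mono_right nhdsWithin_le_nhds)
  rw [integral_of_hasDerivAt_of_nonneg (fun v ↦ ?_) (fun v ↦ ?_) hbot htop]
  · norm_num [zero_rpow (div_ne_zero hm0 two_ne_zero)]
  · have hc := cos_arctan_pos v
    have hsc := sin_sq_add_cos_sq (arctan v)
    have hc2 := cos_sq_arctan v
    have h1 : 0 < 1 + sin (arctan v) := by nlinarith [neg_one_le_sin (arctan v)]
    have := ((((hasDerivAt_arctan v).sin.const_add 1).rpow_const (p := (m : ℝ) / 2)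
      (.inl h1.ne')).const_mul (2 / (m : ℝ)))
    refine this.congr_deriv ?_
    rw [← hc2]
    set c := cos (arctan v)
    set s := sin (arctan v)
    have h3 : 1 - s = c ^ (2 : ℝ) * (1 + s)⁻¹ := by
      rw [rpow_two]
      field_simp
      linarith
    have h4 : c ^ (2 - (m : ℝ)) * c ^ (m + 1) = c ^ 3 := by
      rw [← rpow_natCast, ← rpow_add hc, ← rpow_natCast]
      congr 1
      push_cast
      ring
    rw [h3, mul_rpow (by positivity) (by positivity), ← rpow_mul hc.le, inv_rpow h1.le,
      ← rpow_neg h1.le, mul_div_cancel₀ _ two_ne_zero, mul_right_comm (c ^ (2 - (m : ℝ))), h4,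
      show -((2 - (m : ℝ)) / 2) = (m : ℝ) / 2 - 1 by ring]
    field_simp
  · have := sin_le_one (arctan v)
    have := cos_arctan_pos v
    exact mul_nonneg (rpow_nonneg (by linarith) _) (by positivity)

theorem integral_cone_abs {m : ℕ} (hm : m ≠ 0) :
    ∫ v : ℝ, |v / √(1 + v ^ 2)| * (√(1 + v ^ 2))⁻¹ ^ (m + 1) = 2 / m := by
  have hm0 : (m : ℝ) ≠ 0 := by exact_mod_cast hm
  have habs (v : ℝ) : |v / √(1 + v ^ 2)| * (√(1 + v ^ 2))⁻¹ ^ (m + 1) =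
      (fun w ↦ sin (arctan w) * cos (arctan w) ^ (m + 1)) |v| := by
    simp only [sin_arctan, cos_arctan, sq_abs, abs_div, one_div, abs_of_nonneg (sqrt_nonneg _)]
  have hF : Continuous fun x : ℝ ↦ -(1 / m) * cos x ^ m := by fun_prop
  have htop := (hF.tendsto (π / 2)).comp
    (tendsto_arctan_atTop.mono_right nhdsWithin_le_nhds)
  rw [integral_congr_ae (.of_forall habs),
    integral_comp_abs (f := fun w ↦ sin (arctan w) * cos (arctan w) ^ (m + 1)),
    integral_Ioi_of_hasDerivAt_of_nonneg' (fun v _ ↦ ?_) (fun v hv ↦ ?_) htop]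
  · simp [hm]
    ring
  · have := (((hasDerivAt_arctan v).cos.pow m).const_mul (-(1 / (m : ℝ))))
    refine this.congr_deriv ?_
    obtain ⟨k, rfl⟩ := Nat.exists_eq_succ_of_ne_zero hm
    rw [← cos_sq_arctan v]
    simp only [Nat.succ_eq_add_one, Nat.add_sub_cancel]
    field_simp
    ring
  · exact mul_nonneg (sin_arctan_nonneg.2 (mem_Ioi.1 hv).le) (pow_nonneg (cos_arctan_pos v).le _)

theorem exists_integral_sphere_eq_mul {m : ℕ} [NeZero m] : ∃ K : ℝ, ∀ g : ℝ → ℝ, Measurable g →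
    (∀ t ≤ 1, 0 ≤ g t) →
    ∫ x in sphere (0 : EuclideanSpace ℝ (Fin (m + 1))) 1, g (x 0) ∂μH[(m : ℝ)] =
      K * ∫ v : ℝ, g (v / √(1 + v ^ 2)) * (√(1 + v ^ 2))⁻¹ ^ (m + 1) := by
  have : Fact (finrank ℝ (EuclideanSpace ℝ (Fin (m + 1))) = m + 1) := ⟨finrank_euclideanSpace_fin⟩
  set S := sphere (0 : EuclideanSpace ℝ (Fin (m + 1))) 1
  let σ := μH[(m : ℝ)].restrict S
  have hfin : IsFiniteMeasure σ := ⟨by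
    rw [Measure.restrict_apply_univ]
    exact hausdorffMeasure_sphere_lt_top⟩
  have hσ (e : EuclideanSpace ℝ (Fin (m + 1)) ≃ₗᵢ[ℝ] EuclideanSpace ℝ (Fin (m + 1))) :
      MeasurePreserving e σ σ := by
    have h := (e.toIsometryEquiv.measurePreserving_hausdorffMeasure m).restrict_preimage
      (isClosed_sphere (x := 0) (ε := 1)).measurableSet
    have hS : e.toIsometryEquiv ⁻¹' S = S := by
      ext x
      simp [S]
    rwa [hS] at h
  have hσ1 : ∀ᵐ x ∂σ, ‖x‖ = 1 :=
    (ae_restrict_mem isClosed_sphere.measurableSet).mono fun x hx ↦ by simpa [S] using hx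
  set B := volume (ball (0 : EuclideanSpace ℝ (Fin (m + 1))) 1)
  have hB0 : B ≠ 0 := (measure_ball_pos _ _ one_pos).ne'
  have hB : B ≠ ∞ := measure_ball_lt_top.ne
  set J := ∫⁻ z : EuclideanSpace ℝ (Fin m), if ‖z‖ < 1 then ENNReal.ofReal ‖z‖ else 0
  refine ⟨(B⁻¹ * (σ univ * J)).toReal, fun g hg hg0 ↦ ?_⟩
  have key := volume_ball_mul_lintegral_sphere hσ hσ1 (g := fun t ↦ ENNReal.ofReal (g t))
    hg.ennreal_ofReal (u := EuclideanSpace.single 0 1) (by simp)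
  simp only [EuclideanSpace.inner_single_right, conj_trivial, one_mul] at key
  rw [lintegral_ball_direction hg.ennreal_ofReal, ← mul_assoc,
    ← ENNReal.eq_div_iff hB0 hB, ENNReal.div_eq_inv_mul, ← mul_assoc] at key
  have hle (v : ℝ) : v / √(1 + v ^ 2) ≤ 1 := sin_arctan v ▸ sin_le_one _
  rw [integral_eq_lintegral_of_nonneg_ae, integral_eq_lintegral_of_nonneg_ae, ← ENNReal.toReal_mul]
  · simp_rw [ENNReal.ofReal_mul (hg0 _ (hle _))]
    exact congrArg _ key
  · exact .of_forall fun v ↦ mul_nonneg (hg0 _ (hle v)) (by positivity)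
  · exact Measurable.aestronglyMeasurable (by fun_prop)
  · filter_upwards [hσ1] with x hx
    refine hg0 _ ((le_abs_self _).trans ?_)
    exact (PiLp.norm_apply_le x 0).trans hx.le
  · exact Measurable.aestronglyMeasurable (by fun_prop)

end



/-- For `n ≥ 2`,
`2^{-(n+1)/2} ∫_{S^{n-1}} (1 - x₁)^{-(n-3)/2} dσ(x) = (1/2) ∫_{S^{n-1}} |x₁| dσ(x)`. -/
theorem statement9 (n : ℕ) (hn : 2 ≤ n) :
    (2 : ℝ) ^ (-((n : ℝ) + 1) / 2) *
        ∫ x in Metric.sphere (0 : EuclideanSpace ℝ (Fin n)) 1,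
          (1 - x ⟨0, by omega⟩) ^ (-((n : ℝ) - 3) / 2) ∂(μH[(n : ℝ) - 1])
      = (1 : ℝ) / 2 *
        ∫ x in Metric.sphere (0 : EuclideanSpace ℝ (Fin n)) 1,
          |x ⟨0, by omega⟩| ∂(μH[(n : ℝ) - 1]) := by
  obtain ⟨m, rfl⟩ : ∃ m, n = m + 1 := ⟨n - 1, by omega⟩
  have hm : m ≠ 0 := by omega
  have : NeZero m := ⟨hm⟩
  have hm0 : (m : ℝ) ≠ 0 := by exact_mod_cast hm
  obtain ⟨K, hK⟩ := exists_integral_sphere_eq_mul (m := m)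
  have h1 := hK (fun t ↦ (1 - t) ^ ((2 - (m : ℝ)) / 2)) (by fun_prop)
    fun t ht ↦ Real.rpow_nonneg (by linarith) _
  have h2 := hK (fun t ↦ |t|) (by fun_prop) fun t _ ↦ abs_nonneg t
  rw [integral_cone_rpow hm] at h1
  rw [integral_cone_abs hm] at h2
  have hd : ((m + 1 : ℕ) : ℝ) - 1 = m := by push_cast; ring
  have he : -(((m + 1 : ℕ) : ℝ) - 3) / 2 = (2 - (m : ℝ)) / 2 := by push_cast; ring
  have hpow : (2 : ℝ) ^ (-(((m + 1 : ℕ) : ℝ) + 1) / 2) * 2 ^ ((m : ℝ) / 2) = 1 / 2 := by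
    rw [← Real.rpow_add two_pos, one_div, ← Real.rpow_neg_one]
    congr 1
    push_cast
    ring
  rw [hd, he]
  refine (congrArg₂ _ rfl h1).trans (Eq.trans ?_ (congrArg₂ _ rfl h2).symm)
  linear_combination K * (2 / m) * hpow
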